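/- arXiv:2403.02434 — 4 statements merged into one kernel-verified Lean document; each statement's English description precedes it below -/
import Mathlib

section
/- Let A be a finite abelian group, F an automorphism of A, and g ∈ A an F-fixed element of order 3 which generates the fixed-point subgroup A^F (so |A^F| = 3). Suppose there exists a group homomorphism ψ : A → ℂˣ with ψ ∘ F = ψ such that ψ(g) is a primitive third root of unity. Then the three elements 1, g, g² lie in pairwise distinct F-conjugacy classes of A, and they form a complete set of representatives of the F-conjugacy classes of A. -/
/-- Let `A` be a finite abelian group, `F` an automorphism of `A`, and `g ∈ A` an `F`-fixed
element of order `3` generating the fixed-point subgroup `A^F` (so `|A^F| = 3`). Suppose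
there is a homomorphism `ψ : A → ℂˣ` with `ψ ∘ F = ψ` such that `ψ g` is a primitive third
root of unity. Then `1, g, g²` lie in pairwise distinct `F`-conjugacy classes of `A`, and
they form a complete set of representatives of the `F`-conjugacy classes of `A`. -/
theorem stmt5 {A : Type*} [CommGroup A] [Finite A] (F : A ≃* A) (g : A)
    (hFg : F g = g) (hord : orderOf g = 3)
    (hgen : ∀ a : A, F a = a → a ∈ Subgroup.zpowers g)
    (ψ : A →* ℂˣ) (hψF : ∀ a : A, ψ (F a) = ψ a) (hψg : orderOf (ψ g) = 3) :
    (¬ ∃ b : A, g = b * 1 * (F b)⁻¹) ∧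
    (¬ ∃ b : A, g ^ 2 = b * 1 * (F b)⁻¹) ∧
    (¬ ∃ b : A, g ^ 2 = b * g * (F b)⁻¹) ∧
    (∀ a : A, (∃ b : A, a = b * 1 * (F b)⁻¹) ∨ (∃ b : A, a = b * g * (F b)⁻¹) ∨
      (∃ b : A, a = b * g ^ 2 * (F b)⁻¹)) := by
  have hψ (b c : A) : ψ (b * c * (F b)⁻¹) = ψ c := by
    simp [hψF]
  have hψ1 : ψ g ≠ 1 := fun h => by simp [h] at hψg
  have hψ2 : ψ g ^ 2 ≠ 1 := fun h => by
    have := orderOf_dvd_of_pow_eq_one h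
    rw [hψg] at this
    omega
  have h1 : ¬ ∃ b : A, g = b * 1 * (F b)⁻¹ := by
    rintro ⟨b, hb⟩
    have := congrArg ψ hb
    rw [hψ, map_one] at this
    exact hψ1 this
  refine ⟨h1, ?_, ?_, ?_⟩
  · rintro ⟨b, hb⟩
    have := congrArg ψ hb
    rw [hψ, map_one, map_pow] at this
    exact hψ2 this
  · rintro ⟨b, hb⟩
    have := congrArg ψ hb
    rw [hψ, map_pow, pow_two] at this
    exact hψ1 (mul_eq_left.mp this)
  · intro a
    let L : A →* A := MonoidHom.id A / F.toMonoidHom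
    have hL (b : A) : L b = b * (F b)⁻¹ := div_eq_mul_inv _ _
    have hker : L.ker = Subgroup.zpowers g := by
      refine le_antisymm (fun b hb => hgen b ?_) ?_
      · rw [MonoidHom.mem_ker, hL, mul_inv_eq_one] at hb
        exact hb.symm
      · rw [Subgroup.zpowers_le, MonoidHom.mem_ker, hL, hFg, mul_inv_cancel]
    have hcard : Nat.card (A ⧸ L.range) = 3 := by
      have hk := L.ker.card_mul_index
      rw [Subgroup.index_ker, hker, Nat.card_zpowers, hord, ← L.range.card_mul_index,
        mul_comm] at hk
      exact (Nat.eq_of_mul_eq_mul_left Nat.card_pos hk).symm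
    have hg : (g : A ⧸ L.range) ≠ 1 := by
      rw [Ne, QuotientGroup.eq_one_iff]
      rintro ⟨b, hb⟩
      exact h1 ⟨b, by rw [mul_one, ← hL, hb]⟩
    have : Fact (Nat.Prime 3) := ⟨Nat.prime_three⟩
    obtain ⟨k, hk⟩ := mem_zpowers_of_prime_card hcard hg (g' := (a : A ⧸ L.range))
    have key (n : ℕ) (hn : k % 3 = n) : ∃ b : A, a = b * g ^ n * (F b)⁻¹ := by
      have hgk : g ^ k = g ^ n := by
        rw [← zpow_mod_orderOf, hord, Nat.cast_ofNat, hn, zpow_natCast]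
      have hk' : ((g ^ n : A) : A ⧸ L.range) = a := by
        rw [← hgk]
        exact hk
      obtain ⟨b, hb⟩ := QuotientGroup.eq.mp hk'
      refine ⟨b, ?_⟩
      rw [mul_right_comm, ← hL, hb, mul_comm, mul_inv_cancel_left]
    have h3 : k % 3 = (0 : ℕ) ∨ k % 3 = (1 : ℕ) ∨ k % 3 = (2 : ℕ) := by omega
    rcases h3 with h | h | h
    · exact Or.inl (by simpa using key 0 h)
    · exact Or.inr (Or.inl (by simpa using key 1 h))
    · exact Or.inr (Or.inr (key 2 h))
end

section
/- Let π : H → G be a surjective group homomorphism with ker π ⊆ Z(H), let h ∈ H and g := π(h), and let δ : C_G(g) → ker π be the homomorphism δ(x) = ẋ⁻¹·h⁻¹·ẋ·h (ẋ any lift of x). Then the image of δ is exactly the set {y⁻¹·h⁻¹·y·h : y ∈ H} ∩ ker π. Consequently, this set is a subgroup of ker π and δ induces a group isomorphism C_G(g)/π(C_H(h)) ≅ {y⁻¹·h⁻¹·y·h : y ∈ H} ∩ ker π. -/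
section CentralExtension

variable {H G : Type*} [Group H] [Group G]

theorem inv_mul_inv_mul_mul_eq_one_iff (h y : H) :
    y⁻¹ * h⁻¹ * y * h = 1 ↔ y ∈ Subgroup.centralizer ({h} : Set H) := by
  rw [Subgroup.mem_centralizer_singleton_iff, ← mul_inv_rev, mul_assoc, inv_mul_eq_one, eq_comm]

theorem inv_mul_inv_mul_mul_mem_ker_iff (π : H →* G) (h y : H) :
    y⁻¹ * h⁻¹ * y * h ∈ π.ker ↔ π y ∈ Subgroup.centralizer ({π h} : Set G) := by
  rw [← inv_mul_inv_mul_mul_eq_one_iff, MonoidHom.mem_ker]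
  simp only [map_mul, map_inv]

theorem inv_mul_inv_mul_mul_congr (π : H →* G) (hker : π.ker ≤ Subgroup.center H) (h : H)
    {a b : H} (hab : π a = π b) : a⁻¹ * h⁻¹ * a * h = b⁻¹ * h⁻¹ * b * h := by
  have hk : b⁻¹ * a ∈ Subgroup.center H :=
    hker (by rw [MonoidHom.mem_ker, map_mul, map_inv, hab, inv_mul_cancel])
  obtain ⟨k, rfl⟩ : ∃ k, a = b * k := ⟨b⁻¹ * a, by group⟩
  rw [inv_mul_cancel_left, Subgroup.mem_center_iff] at hk
  calc (b * k)⁻¹ * h⁻¹ * (b * k) * h = k⁻¹ * (b⁻¹ * h⁻¹ * b * k) * h := by group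
    _ = b⁻¹ * h⁻¹ * b * h := by rw [hk]; group

theorem inv_mul_inv_mul_mul_mul {π : H →* G} (hker : π.ker ≤ Subgroup.center H) (h : H)
    {a b : H} (ha : π a ∈ Subgroup.centralizer ({π h} : Set G)) :
    (a * b)⁻¹ * h⁻¹ * (a * b) * h = (a⁻¹ * h⁻¹ * a * h) * (b⁻¹ * h⁻¹ * b * h) := by
  have hc := Subgroup.mem_center_iff.mp
    (hker ((inv_mul_inv_mul_mul_mem_ker_iff π h a).mpr ha)) b⁻¹
  calc (a * b)⁻¹ * h⁻¹ * (a * b) * h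
      = b⁻¹ * (a⁻¹ * h⁻¹ * a * h) * (h⁻¹ * b * h) := by group
    _ = (a⁻¹ * h⁻¹ * a * h) * (b⁻¹ * h⁻¹ * b * h) := by rw [hc]; group

/-- The homomorphism `x ↦ xl⁻¹ * h⁻¹ * xl * h` on the centralizer of `π h`, where `xl` is a lift
of `x` along the central extension `π`. -/
noncomputable def centralizerCommutatorHom (π : H →* G) (hsurj : Function.Surjective π)
    (hker : π.ker ≤ Subgroup.center H) (h : H) :
    Subgroup.centralizer ({π h} : Set G) →* H :=
  MonoidHom.mk'
    (fun x => (Function.surjInv hsurj x)⁻¹ * h⁻¹ * Function.surjInv hsurj x * h)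
    fun x y => by
      rw [← inv_mul_inv_mul_mul_mul hker h (by rw [Function.surjInv_eq hsurj]; exact x.2)]
      exact inv_mul_inv_mul_mul_congr π hker h (by simp [Function.surjInv_eq])

theorem centralizerCommutatorHom_apply (π : H →* G) (hsurj : Function.Surjective π)
    (hker : π.ker ≤ Subgroup.center H) (h : H) (x : Subgroup.centralizer ({π h} : Set G))
    {y : H} (hy : π y = x) :
    centralizerCommutatorHom π hsurj hker h x = y⁻¹ * h⁻¹ * y * h :=
  inv_mul_inv_mul_mul_congr π hker h (by rw [Function.surjInv_eq hsurj, hy])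

theorem range_centralizerCommutatorHom (π : H →* G) (hsurj : Function.Surjective π)
    (hker : π.ker ≤ Subgroup.center H) (h : H) :
    Set.range (centralizerCommutatorHom π hsurj hker h) =
      {z : H | (∃ y : H, z = y⁻¹ * h⁻¹ * y * h) ∧ z ∈ π.ker} := by
  ext z
  constructor
  · rintro ⟨x, rfl⟩
    obtain ⟨y, hy⟩ := hsurj x
    rw [centralizerCommutatorHom_apply π hsurj hker h x hy]
    exact ⟨⟨y, rfl⟩, (inv_mul_inv_mul_mul_mem_ker_iff π h y).mpr (hy ▸ x.2)⟩
  · rintro ⟨⟨y, rfl⟩, hz⟩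
    exact ⟨⟨π y, (inv_mul_inv_mul_mul_mem_ker_iff π h y).mp hz⟩,
      centralizerCommutatorHom_apply π hsurj hker h _ rfl⟩

theorem centralizerCommutatorHom_eq_one_iff (π : H →* G) (hsurj : Function.Surjective π)
    (hker : π.ker ≤ Subgroup.center H) (h : H) (x : Subgroup.centralizer ({π h} : Set G)) :
    centralizerCommutatorHom π hsurj hker h x = 1 ↔
      (x : G) ∈ π '' (Subgroup.centralizer ({h} : Set H) : Set H) := by
  constructor
  · intro hx
    obtain ⟨y, hy⟩ := hsurj x
    rw [centralizerCommutatorHom_apply π hsurj hker h x hy, inv_mul_inv_mul_mul_eq_one_iff] at hx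
    exact ⟨y, hx, hy⟩
  · rintro ⟨y, hyh, hy⟩
    rw [centralizerCommutatorHom_apply π hsurj hker h x hy]
    exact (inv_mul_inv_mul_mul_eq_one_iff h y).mpr hyh

end CentralExtension


/-- Let `π : H → G` be a surjective group homomorphism with `ker π ⊆ Z(H)`, let `h ∈ H`,
`g := π h`, and let `δ : C_G(g) → ker π` be the homomorphism `δ(x) = xl⁻¹ * h⁻¹ * xl * h`
(`xl` any lift of `x`). Then the image of `δ` is exactly
`{y⁻¹ * h⁻¹ * y * h : y ∈ H} ∩ ker π`. Consequently, this set is a subgroup of `ker π`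
and `δ` induces a group isomorphism `C_G(g)/π(C_H(h)) ≅ {y⁻¹ * h⁻¹ * y * h : y ∈ H} ∩ ker π`
(expressed here as: there is a surjective homomorphism from `C_G(g)` onto that subgroup
whose kernel is exactly `π(C_H(h))`). -/
theorem stmt8 {H G : Type*} [Group H] [Group G] (π : H →* G)
    (hsurj : Function.Surjective π) (hker : π.ker ≤ Subgroup.center H) (h : H) :
    ∃ δ : Subgroup.centralizer ({π h} : Set G) →* H,
      (∀ (x : Subgroup.centralizer ({π h} : Set G)) (xl : H), π xl = (x : G) →
        δ x = xl⁻¹ * h⁻¹ * xl * h) ∧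
      Set.range δ = {z : H | (∃ y : H, z = y⁻¹ * h⁻¹ * y * h) ∧ z ∈ π.ker} ∧
      ∃ K : Subgroup H,
        (K : Set H) = {z : H | (∃ y : H, z = y⁻¹ * h⁻¹ * y * h) ∧ z ∈ π.ker} ∧
        K ≤ π.ker ∧
        ∃ f : Subgroup.centralizer ({π h} : Set G) →* K,
          Function.Surjective f ∧
          ∀ x : Subgroup.centralizer ({π h} : Set G),
            f x = 1 ↔ (x : G) ∈ π '' (Subgroup.centralizer ({h} : Set H) : Set H) := by
  let δ := centralizerCommutatorHom π hsurj hker h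
  have hrange := range_centralizerCommutatorHom π hsurj hker h
  refine ⟨δ, fun x _ => centralizerCommutatorHom_apply π hsurj hker h x, hrange, δ.range,
    δ.coe_range.trans hrange, ?_, δ.rangeRestrict, δ.rangeRestrict_surjective, fun x => ?_⟩
  · exact fun z hz => (hrange.subset hz).2
  · rw [← centralizerCommutatorHom_eq_one_iff π hsurj hker h x, Subtype.ext_iff]
    rfl
end

section
/- Let H be a group, F : H → H a group endomorphism, and H^F := {h ∈ H : F(h) = h}. Let g₁, g₂ ∈ H^F and x₁, x₂ ∈ H with g₁ = x₁⁻¹·F(x₁) and g₂ = x₂⁻¹·F(x₂). If g₂ = h·g₁·h⁻¹ for some h ∈ H^F (in particular, if g₁ = g₂), then there exists u ∈ H^F with x₂·g₂·x₂⁻¹ = u·(x₁·g₁·x₁⁻¹)·u⁻¹. Thus the H^F-conjugacy class of x·g·x⁻¹ depends only on the H^F-conjugacy class of g and not on the choice of g in that class or of the element x trivializing it. -/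
/-- Let `H` be a group, `F : H → H` a group endomorphism, `H^F` its fixed-point set.
Let `g₁, g₂ ∈ H^F` and `x₁, x₂ ∈ H` with `g₁ = x₁⁻¹ * F x₁` and `g₂ = x₂⁻¹ * F x₂`.
If `g₂ = h * g₁ * h⁻¹` for some `h ∈ H^F`, then there exists `u ∈ H^F` with
`x₂ * g₂ * x₂⁻¹ = u * (x₁ * g₁ * x₁⁻¹) * u⁻¹`; thus the `H^F`-conjugacy class of
`x * g * x⁻¹` depends only on the `H^F`-class of `g`. -/
theorem stmt11 {H : Type*} [Group H] (F : H →* H) (g₁ g₂ x₁ x₂ h : H)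
    (hg₁ : F g₁ = g₁) (hg₂ : F g₂ = g₂)
    (hx₁ : g₁ = x₁⁻¹ * F x₁) (hx₂ : g₂ = x₂⁻¹ * F x₂)
    (hh : F h = h) (hconj : g₂ = h * g₁ * h⁻¹) :
    ∃ u : H, F u = u ∧ x₂ * g₂ * x₂⁻¹ = u * (x₁ * g₁ * x₁⁻¹) * u⁻¹ := by
  have hF₁ : F x₁ = x₁ * g₁ := by rw [hx₁, mul_inv_cancel_left]
  have hF₂ : F x₂ = x₂ * g₂ := by rw [hx₂, mul_inv_cancel_left]
  refine ⟨x₂ * h * x₁⁻¹, ?_, ?_⟩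
  · rw [map_mul, map_mul, map_inv, hF₁, hF₂, hh, hconj]
    group
  · rw [hconj]
    group
end

section
/- Let H be a group, F : H → H a group endomorphism, g₀ ∈ H with F(g₀) = g₀, and ȧ ∈ H an element centralizing g₀. Suppose x, v ∈ H satisfy x⁻¹·F(x) = ȧ and v⁻¹·F(v) = g₀·ȧ. Set g_a := x·g₀·x⁻¹ and w := v·x⁻¹. Then F(g_a) = g_a, w⁻¹·F(w) = g_a, and w·g_a·w⁻¹ = v·g₀·v⁻¹. -/
/-- Let `H` be a group, `F : H → H` a group endomorphism, `g₀ ∈ H` with `F g₀ = g₀`, and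
`a ∈ H` an element centralizing `g₀`. Suppose `x, v ∈ H` satisfy `x⁻¹ * F x = a` and
`v⁻¹ * F v = g₀ * a`. Set `g_a := x * g₀ * x⁻¹` and `w := v * x⁻¹`. Then `F g_a = g_a`,
`w⁻¹ * F w = g_a`, and `w * g_a * w⁻¹ = v * g₀ * v⁻¹`. -/
theorem stmt12 {H : Type*} [Group H] (F : H →* H) (g₀ a x v : H)
    (hg₀ : F g₀ = g₀) (ha : a * g₀ = g₀ * a)
    (hx : x⁻¹ * F x = a) (hv : v⁻¹ * F v = g₀ * a) :
    F (x * g₀ * x⁻¹) = x * g₀ * x⁻¹ ∧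
    (v * x⁻¹)⁻¹ * F (v * x⁻¹) = x * g₀ * x⁻¹ ∧
    (v * x⁻¹) * (x * g₀ * x⁻¹) * (v * x⁻¹)⁻¹ = v * g₀ * v⁻¹ := by
  have hFx : F x = x * a := inv_mul_eq_iff_eq_mul.mp hx
  have hFv : F v = v * (g₀ * a) := inv_mul_eq_iff_eq_mul.mp hv
  refine ⟨?_, ?_, by group⟩
  · rw [map_mul, map_mul, map_inv, hFx, hg₀, mul_assoc x a g₀, ha]
    group
  · rw [map_mul, map_inv, hFx, hFv]
    group
end
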